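/- Consider a QVE x = a + b(x,x) with nonnegative bilinear b, a ≥ 0, a + b(e,e) = e, and suppose R_{ij} = 0 for all i > M and j ≤ M. Let x = (x1; x2) ∈ ℝ^N with x > 0 be partitioned into its first M and last N−M components. If T_{x2} is nonsingular, x2 = a2 + b2(x2,x2), and x1 = a_{x2} + b_{x2}(x1,x1), then x solves the QVE x = a + b(x,x). -/

import Mathlib

open Matrix

/-- The projection `P = [I 0]` onto the first `M` of `M + K` coordinates. -/
def Pmat (M K : ℕ) : Matrix (Fin M) (Fin (M + K)) ℝ :=
  Matrix.of fun i j => if (j : ℕ) = (i : ℕ) then 1 else 0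

/-- The projection `Q = [0 I]` onto the last `K` of `M + K` coordinates. -/
def Qmat (M K : ℕ) : Matrix (Fin K) (Fin (M + K)) ℝ :=
  Matrix.of fun i j => if (j : ℕ) = M + (i : ℕ) then 1 else 0

/-- `T_y := I_M - P b(·, Qᵀy) Pᵀ - P b(Qᵀy, ·) Pᵀ`. -/
noncomputable def Tmat (M K : ℕ)
    (b : (Fin (M + K) → ℝ) →ₗ[ℝ] (Fin (M + K) → ℝ) →ₗ[ℝ] (Fin (M + K) → ℝ))
    (y : Fin K → ℝ) : Matrix (Fin M) (Fin M) ℝ :=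
  1 - Pmat M K * LinearMap.toMatrix' (b.flip ((Qmat M K)ᵀ.mulVec y)) * (Pmat M K)ᵀ
    - Pmat M K * LinearMap.toMatrix' (b ((Qmat M K)ᵀ.mulVec y)) * (Pmat M K)ᵀ

/-- `b_2(u,v) := Q b(Qᵀu, Qᵀv)`. -/
def b2 (M K : ℕ)
    (b : (Fin (M + K) → ℝ) →ₗ[ℝ] (Fin (M + K) → ℝ) →ₗ[ℝ] (Fin (M + K) → ℝ))
    (u v : Fin K → ℝ) : Fin K → ℝ :=
  (Qmat M K).mulVec (b ((Qmat M K)ᵀ.mulVec u) ((Qmat M K)ᵀ.mulVec v))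

/-- `a_y := T_y⁻¹ (a_1 + P b(Qᵀy, Qᵀy))` where `a_1 = P a`. -/
noncomputable def aSub (M K : ℕ)
    (b : (Fin (M + K) → ℝ) →ₗ[ℝ] (Fin (M + K) → ℝ) →ₗ[ℝ] (Fin (M + K) → ℝ))
    (a : Fin (M + K) → ℝ) (y : Fin K → ℝ) : Fin M → ℝ :=
  (Tmat M K b y)⁻¹.mulVec
    ((Pmat M K).mulVec a
      + (Pmat M K).mulVec (b ((Qmat M K)ᵀ.mulVec y) ((Qmat M K)ᵀ.mulVec y)))

/-- `b_y(u,v) := T_y⁻¹ P b(Pᵀu, Pᵀv)`. -/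
noncomputable def bSub (M K : ℕ)
    (b : (Fin (M + K) → ℝ) →ₗ[ℝ] (Fin (M + K) → ℝ) →ₗ[ℝ] (Fin (M + K) → ℝ))
    (y : Fin K → ℝ) (u v : Fin M → ℝ) : Fin M → ℝ :=
  (Tmat M K b y)⁻¹.mulVec
    ((Pmat M K).mulVec (b ((Pmat M K)ᵀ.mulVec u) ((Pmat M K)ᵀ.mulVec v)))

theorem Pmat_mulVec_apply {M K : ℕ} (w : Fin (M + K) → ℝ) (i : Fin M) :
    (Pmat M K).mulVec w i = w (Fin.castAdd K i) := by
  have h (j : Fin (M + K)) : (j : ℕ) = (i : ℕ) ↔ j = Fin.castAdd K i := by simp [Fin.ext_iff]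
  simp [Pmat, Matrix.mulVec, dotProduct, h]

theorem Qmat_mulVec_apply {M K : ℕ} (w : Fin (M + K) → ℝ) (i : Fin K) :
    (Qmat M K).mulVec w i = w (Fin.natAdd M i) := by
  have h (j : Fin (M + K)) : (j : ℕ) = M + (i : ℕ) ↔ j = Fin.natAdd M i := by simp [Fin.ext_iff]
  simp [Qmat, Matrix.mulVec, dotProduct, h]

theorem Pmat_transpose_mulVec_castAdd {M K : ℕ} (u : Fin M → ℝ) (i : Fin M) :
    (Pmat M K)ᵀ.mulVec u (Fin.castAdd K i) = u i := by
  simp [Pmat, Matrix.mulVec, dotProduct, Fin.val_inj]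

theorem Pmat_transpose_mulVec_natAdd {M K : ℕ} (u : Fin M → ℝ) (i : Fin K) :
    (Pmat M K)ᵀ.mulVec u (Fin.natAdd M i) = 0 := by
  have h (j : Fin M) : M + (i : ℕ) ≠ (j : ℕ) := by omega
  simp [Pmat, Matrix.mulVec, dotProduct, h]

theorem Qmat_transpose_mulVec_castAdd {M K : ℕ} (v : Fin K → ℝ) (i : Fin M) :
    (Qmat M K)ᵀ.mulVec v (Fin.castAdd K i) = 0 := by
  have h (j : Fin K) : (i : ℕ) ≠ M + (j : ℕ) := by omega
  simp [Qmat, Matrix.mulVec, dotProduct, h]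

theorem Qmat_transpose_mulVec_natAdd {M K : ℕ} (v : Fin K → ℝ) (i : Fin K) :
    (Qmat M K)ᵀ.mulVec v (Fin.natAdd M i) = v i := by
  simp [Qmat, Matrix.mulVec, dotProduct, Fin.val_inj]

theorem Pmat_add_Qmat_mulVec {M K : ℕ} (x : Fin (M + K) → ℝ) :
    (Pmat M K)ᵀ.mulVec ((Pmat M K).mulVec x) + (Qmat M K)ᵀ.mulVec ((Qmat M K).mulVec x) = x := by
  ext i
  refine Fin.addCases (fun i => ?_) (fun i => ?_) i
  · simp only [Pi.add_apply, Pmat_transpose_mulVec_castAdd, Qmat_transpose_mulVec_castAdd,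
      Pmat_mulVec_apply, add_zero]
  · simp only [Pi.add_apply, Pmat_transpose_mulVec_natAdd, Qmat_transpose_mulVec_natAdd,
      Qmat_mulVec_apply, zero_add]

theorem bilin_apply_eq_sum {n : ℕ} (b : (Fin n → ℝ) →ₗ[ℝ] (Fin n → ℝ) →ₗ[ℝ] (Fin n → ℝ))
    (u v : Fin n → ℝ) (i : Fin n) :
    b u v i = ∑ j, ∑ k, u j * v k * b (Pi.single j 1) (Pi.single k 1) i := by
  conv_lhs => rw [pi_eq_sum_univ' u, pi_eq_sum_univ' v]
  simp only [map_sum, map_smul, LinearMap.sum_apply, LinearMap.smul_apply, Finset.sum_apply,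
    Pi.smul_apply, smul_eq_mul, Finset.mul_sum]
  rw [Finset.sum_comm]
  refine Finset.sum_congr rfl fun j _ => Finset.sum_congr rfl fun k _ => ?_
  ring

theorem Tmat_mulVec {M K : ℕ}
    (b : (Fin (M + K) → ℝ) →ₗ[ℝ] (Fin (M + K) → ℝ) →ₗ[ℝ] (Fin (M + K) → ℝ))
    (y : Fin K → ℝ) (u : Fin M → ℝ) :
    (Tmat M K b y).mulVec u = u
      - (Pmat M K).mulVec (b ((Pmat M K)ᵀ.mulVec u) ((Qmat M K)ᵀ.mulVec y))
      - (Pmat M K).mulVec (b ((Qmat M K)ᵀ.mulVec y) ((Pmat M K)ᵀ.mulVec u)) := by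
  simp only [Tmat, sub_mulVec, one_mulVec, ← mulVec_mulVec, LinearMap.toMatrix'_mulVec,
    LinearMap.flip_apply]

/-- conversely, if `T_{x₂}` is nonsingular and the block
components `x₂`, `x₁` of `x > 0` solve the two reduced QVEs, then `x` solves
the original QVE `x = a + b(x,x)`. -/
theorem stmt_6 {M K : ℕ} (hM : 1 ≤ M) (hK : 1 ≤ K)
    (b : (Fin (M + K) → ℝ) →ₗ[ℝ] (Fin (M + K) → ℝ) →ₗ[ℝ] (Fin (M + K) → ℝ))
    (hb : ∀ i j k : Fin (M + K), 0 ≤ b (Pi.single j 1) (Pi.single k 1) i)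
    (a : Fin (M + K) → ℝ) (ha : 0 ≤ a)
    (he : a + b (fun _ => 1) (fun _ => 1) = fun _ => 1)
    (hR : ∀ i j : Fin (M + K), M ≤ (i : ℕ) → (j : ℕ) < M →
      ∑ k, (b (Pi.single j 1) (Pi.single k 1) i + b (Pi.single k 1) (Pi.single j 1) i) = 0)
    (x : Fin (M + K) → ℝ) (hx : ∀ i, 0 < x i)
    (x1 : Fin M → ℝ) (hx1 : x1 = (Pmat M K).mulVec x)
    (x2 : Fin K → ℝ) (hx2 : x2 = (Qmat M K).mulVec x)
    (hT : IsUnit (Tmat M K b x2))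
    (h2 : x2 = (Qmat M K).mulVec a + b2 M K b x2 x2)
    (h1 : x1 = aSub M K b a x2 + bSub M K b x2 x1 x1) :
    x = a + b x x := by
  have hcoef (i : Fin K) (j : Fin M) (k : Fin (M + K)) :
      b (Pi.single (Fin.castAdd K j) 1) (Pi.single k 1) (Fin.natAdd M i) = 0 ∧
        b (Pi.single k 1) (Pi.single (Fin.castAdd K j) 1) (Fin.natAdd M i) = 0 := by
    have h := (Finset.sum_eq_zero_iff_of_nonneg fun k _ => add_nonneg (hb _ _ k) (hb _ k _)).1
      (hR (Fin.natAdd M i) (Fin.castAdd K j) (by simp) (by simp)) k (Finset.mem_univ k)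
    exact (add_eq_zero_iff_of_nonneg (hb _ _ _) (hb _ _ _)).1 h
  have hleft (u : Fin M → ℝ) (w : Fin (M + K) → ℝ) (i : Fin K) :
      b ((Pmat M K)ᵀ.mulVec u) w (Fin.natAdd M i) = 0 := by
    rw [bilin_apply_eq_sum]
    simp [Fin.sum_univ_add, Pmat_transpose_mulVec_natAdd, hcoef]
  have hright (u : Fin M → ℝ) (w : Fin (M + K) → ℝ) (i : Fin K) :
      b w ((Pmat M K)ᵀ.mulVec u) (Fin.natAdd M i) = 0 := by
    rw [bilin_apply_eq_sum]
    simp [Fin.sum_univ_add, Pmat_transpose_mulVec_natAdd, hcoef]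
  have hx12 : x = (Pmat M K)ᵀ.mulVec x1 + (Qmat M K)ᵀ.mulVec x2 := by
    rw [hx1, hx2, Pmat_add_Qmat_mulVec]
  have hbx : b x x = b ((Pmat M K)ᵀ.mulVec x1) ((Pmat M K)ᵀ.mulVec x1)
      + b ((Pmat M K)ᵀ.mulVec x1) ((Qmat M K)ᵀ.mulVec x2)
      + b ((Qmat M K)ᵀ.mulVec x2) ((Pmat M K)ᵀ.mulVec x1)
      + b ((Qmat M K)ᵀ.mulVec x2) ((Qmat M K)ᵀ.mulVec x2) := by
    rw [hx12]
    simp only [map_add, LinearMap.add_apply]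
    abel
  have hTx := congrArg (Tmat M K b x2).mulVec h1
  rw [Tmat_mulVec, aSub, bSub, ← mulVec_add, mulVec_mulVec,
    mul_nonsing_inv _ ((isUnit_iff_isUnit_det _).1 hT), one_mulVec] at hTx
  ext i
  refine Fin.addCases (fun i => ?_) (fun i => ?_) i
  · have h := congrFun hTx i
    have h' := congrFun hx1 i
    simp only [Pi.sub_apply, Pi.add_apply, Pmat_mulVec_apply] at h h'
    rw [hbx]
    simp only [Pi.add_apply]
    linarith
  · have h := congrFun h2 i
    have h' := congrFun hx2 i
    simp only [b2, Pi.add_apply, Qmat_mulVec_apply] at h h'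
    rw [hbx]
    simp only [Pi.add_apply, hleft, hright]
    linarith
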